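/- Let → be a binary relation on a set S. Let a be an element of the domain of → and let a' be a →-normal form of a. Set A := {b | a →* b} and let →₄ be the domain-restriction of → to A. Assume: (i) there is an upper bound n ∈ ℕ on the length of →-derivations from a to a', i.e., m ≤ n for every m ∈ ℕ and every sequence b₀, …, b_m with a = b₀, b_i → b_{i+1} for each i ∈ {0, …, m−1}, and b_m = a'; (ii) for all b₁, b₂ such that some c satisfies c →₄ b₁ and c → b₂, there is d with b₁ →₄* d and b₂ →₄* d. Then the reverse of →₄ is well-founded. -/

import Mathlib

open Relation

inductive DerivLen {S : Type*} (r : S → S → Prop) (t : S) : ℕ → S → Prop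
  | zero : DerivLen r t 0 t
  | succ {m : ℕ} {x y : S} : r x y → DerivLen r t m y → DerivLen r t (m + 1) x

theorem DerivLen.toSeq {S : Type*} {r : S → S → Prop} {t : S} {m : ℕ} {x : S}
    (h : DerivLen r t m x) :
    ∃ b : ℕ → S, b 0 = x ∧ (∀ i < m, r (b i) (b (i + 1))) ∧ b m = t := by
  induction h with
  | zero => exact ⟨fun _ => t, rfl, by simp, rfl⟩
  | @succ m x y hxy _ ih =>
    obtain ⟨b, h0, hs, ht⟩ := ih
    refine ⟨fun i => Nat.casesOn i x b, rfl, ?_, ht⟩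
    intro i him
    cases i with
    | zero => simpa [h0] using hxy
    | succ i => exact hs i (by omega)

theorem DerivLen.ofRtg {S : Type*} {r : S → S → Prop} {t x : S}
    (h : ReflTransGen r x t) : ∃ m, DerivLen r t m x := by
  induction h using ReflTransGen.head_induction_on with
  | refl => exact ⟨0, .zero⟩
  | head hxy _ ih =>
    obtain ⟨m, hm⟩ := ih
    exact ⟨m + 1, .succ hxy hm⟩

theorem klop_key {S : Type*} (r r4 : S → S → Prop) (A : Set S) (a a' : S)
    (hA : ∀ b, b ∈ A ↔ ReflTransGen r a b)
    (hr4 : ∀ x y, r4 x y ↔ r x y ∧ x ∈ A)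
    (hnf₂ : ∀ b, ¬ r a' b)
    (hii : ∀ b₁ b₂, (∃ c, r4 c b₁ ∧ r c b₂) →
      ∃ d, ReflTransGen r4 b₁ d ∧ ReflTransGen r4 b₂ d) (k : ℕ) :
    ∀ x ∈ A, ReflTransGen r x a' → (∀ m, DerivLen r a' m x → m ≤ k) →
      Acc (fun x y => r4 y x) x ∧ ∀ y, ReflTransGen r x y → ReflTransGen r y a' := by
  have mono : ∀ {x y}, ReflTransGen r4 x y → ReflTransGen r x y := fun h =>
    ReflTransGen.mono (fun x y h => ((hr4 x y).1 h).1) _ _ h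
  induction k with
  | zero =>
    intro x _ hx hb
    rcases hx.cases_head with rfl | ⟨z, hxz, hz⟩
    · refine ⟨⟨_, fun y hy => absurd ((hr4 _ _).1 hy).1 (hnf₂ y)⟩, fun y hy => ?_⟩
      rcases hy.cases_head with rfl | ⟨w, hw, _⟩
      · exact .refl
      · exact absurd hw (hnf₂ w)
    · obtain ⟨m, hm⟩ := DerivLen.ofRtg hz
      have := hb _ (.succ hxz hm)
      omega
  | succ k ih =>
    intro x hxA hx hb
    have step : ∀ y, r x y → ReflTransGen r y a' →
        Acc (fun x y => r4 y x) y ∧ ∀ w, ReflTransGen r y w → ReflTransGen r w a' := by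
      intro y hxy hy
      refine ih y ((hA y).2 (((hA x).1 hxA).tail hxy)) hy fun m hm => ?_
      have := hb _ (.succ hxy hm)
      omega
    have main : ∀ y, r x y → ReflTransGen r y a' := by
      intro y hxy
      rcases hx.cases_head with rfl | ⟨z, hxz, hz⟩
      · exact absurd hxy (hnf₂ y)
      · obtain ⟨d, hyd, hzd⟩ := hii y z ⟨x, (hr4 _ _).2 ⟨hxy, hxA⟩, hxz⟩
        exact (mono hyd).trans ((step z hxz hz).2 d (mono hzd))
    refine ⟨⟨_, fun y hy => ?_⟩, fun y hy => ?_⟩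
    · have h := ((hr4 _ _).1 hy).1
      exact (step y h (main y h)).1
    · rcases hy.cases_head with rfl | ⟨w, hw, hwy⟩
      · exact hx
      · exact (step w hw (main w hw)).2 y hwy

/-- Klop's Theorem I.5.18, the specialization of the paper's
main theorem to `→₀ := ∅`.  Let `→` be a relation, `a` in its domain, `a'` a
`→`-normal form of `a`, `A = {b | a →* b}`, and `→₄` the domain-restriction
of `→` to `A`.  If (i) there is a bound `n` on the length of `→`-derivations
from `a` to `a'`, and (ii) peaks of `→₄` against `→` are joinable by `→₄*`,
then the reverse of `→₄` is well-founded. -/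
theorem stmt3 {S : Type*} (r r4 : S → S → Prop) (A : Set S) (a a' : S) (n : ℕ)
    (hA : ∀ b, b ∈ A ↔ ReflTransGen r a b)
    (hr4 : ∀ x y, r4 x y ↔ r x y ∧ x ∈ A)
    (hadom : ∃ b, r a b)
    (hnf₁ : ReflTransGen r a a')
    (hnf₂ : ∀ b, ¬ r a' b)
    -- (i) upper bound n on the length of →-derivations from a to a'
    (hi : ∀ (m : ℕ) (b : ℕ → S), b 0 = a → (∀ i < m, r (b i) (b (i + 1))) →
      b m = a' → m ≤ n)
    -- (ii) peaks of →₄ against → are joinable by →₄* on both sides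
    (hii : ∀ b₁ b₂, (∃ c, r4 c b₁ ∧ r c b₂) →
      ∃ d, ReflTransGen r4 b₁ d ∧ ReflTransGen r4 b₂ d) :
    WellFounded (fun x y => r4 y x) := by
  have key := klop_key r r4 A a a' hA hr4 hnf₂ hii n a ((hA a).2 .refl) hnf₁ (by
    intro m hm
    obtain ⟨b, h0, hs, ht⟩ := hm.toSeq
    exact hi m b h0 hs ht)
  refine ⟨fun x => ?_⟩
  by_cases hx : x ∈ A
  · have hax := (hA x).1 hx
    clear hx
    induction hax with
    | refl => exact key.1
    | tail hab hbc ih => exact ih.inv ((hr4 _ _).2 ⟨hbc, (hA _).2 hab⟩)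
  · exact ⟨_, fun y hy => absurd ((hr4 _ _).1 hy).2 hx⟩
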